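/- For every integer n ≥ 7 and every t with 0 ≤ t ≤ r_{n+3} − r_{n+2}, one has 4 n r_{n+2} · H_{n−2}(r_{n+2}) ≤ 2n (2 r_{n+2} + t) · H_{n−2}(r_{n+2} + t). -/

import Mathlib

open Real

/-- `h_m(s) = e^{-s²/4} s^m`. -/
noncomputable def hfun (m : ℕ) (s : ℝ) : ℝ := Real.exp (-s ^ 2 / 4) * s ^ m

/-- `H_m(s) = h_m(s-2) + h_m(s+2)`. -/
noncomputable def Hfun (m : ℕ) (s : ℝ) : ℝ := hfun m (s - 2) + hfun m (s + 2)

/-- `r_m = √(2(m-1))`. -/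
noncomputable def rrad (m : ℕ) : ℝ := Real.sqrt (2 * ((m : ℝ) - 1))

theorem log_add_two_div_sub_two_le {s : ℝ} (hs : 2 < s) :
    log ((s + 2) / (s - 2)) ≤ 4 * s / (s ^ 2 - 4) := by
  have hs0 : 0 < s := by linarith
  have h := log_div_le_sum_range_add (x := 2 / s) (by positivity)
    (by rw [div_lt_one hs0]; exact hs) 0
  have h2 : s - 2 ≠ 0 := by linarith
  have h3 : s ^ 2 - 4 ≠ 0 := by nlinarith
  have e1 : (1 + 2 / s) / (1 - 2 / s) = (s + 2) / (s - 2) := by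
    field_simp
  have e2 : 2 / s / (1 - (2 / s) ^ 2) = 2 * s / (s ^ 2 - 4) := by
    have : 1 - (2 / s) ^ 2 = (s ^ 2 - 4) / s ^ 2 := by field_simp; ring
    rw [this]; field_simp
  have e3 : 4 * s / (s ^ 2 - 4) = 2 * (2 * s / (s ^ 2 - 4)) := by ring
  rw [e1] at h
  simp only [Finset.range_zero, Finset.sum_empty, mul_zero, zero_add, pow_one] at h
  rw [e2] at h
  linarith

theorem hasDerivAt_hfun (k : ℕ) (s : ℝ) :
    HasDerivAt (hfun (k + 1))
      (exp (-s ^ 2 / 4) * s ^ k * (2 * (k + 1) - s ^ 2) / 2) s := by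
  have h1 : HasDerivAt (fun s : ℝ => -s ^ 2 / 4) (-(2 * s) / 4) s := by
    simpa using ((hasDerivAt_pow 2 s).neg.div_const 4)
  have h := h1.exp.mul (hasDerivAt_pow (k + 1) s)
  refine h.congr_deriv ?_
  push_cast
  ring

theorem hasDerivAt_Hfun (k : ℕ) (s : ℝ) :
    HasDerivAt (Hfun (k + 1))
      (exp (-(s - 2) ^ 2 / 4) * (s - 2) ^ k * (2 * (k + 1) - (s - 2) ^ 2) / 2
        + exp (-(s + 2) ^ 2 / 4) * (s + 2) ^ k * (2 * (k + 1) - (s + 2) ^ 2) / 2) s :=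
  ((hasDerivAt_hfun k (s - 2)).comp_sub_const s 2).add
    ((hasDerivAt_hfun k (s + 2)).comp_add_const s 2)

/-- The two bumps of `Hfun` compared at `s`, where `c = s² - 2(k+1)`. -/
theorem exp_mul_pow_add_two_le {k : ℕ} {s c : ℝ} (hs : 4 ≤ s)
    (hc : s ^ 2 = 2 * (k + 1) + c) (hc6 : 6 ≤ c) (hc8 : c ≤ 8) :
    exp (-(s + 2) ^ 2 / 4) * (s + 2) ^ k * (4 * s + 4 + c)
      ≤ exp (-(s - 2) ^ 2 / 4) * (s - 2) ^ k * (4 * s - 4 - c) := by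
  have hm : 0 < s - 2 := by linarith
  have hp : 0 < s + 2 := by linarith
  have hM : 0 < 4 * s - 4 - c := by linarith
  have hM' : 4 * (s - 1) - c ≠ 0 := by linarith
  have hP : 0 < 4 * s + 4 + c := by linarith
  have hsq : 0 < s ^ 2 - 4 := by nlinarith
  have hL := log_add_two_div_sub_two_le (show 2 < s by linarith)
  set L := log ((s + 2) / (s - 2)) with hLdef
  have hexpL : s + 2 = (s - 2) * exp L := by
    rw [hLdef, exp_log (by positivity)]; field_simp
  set Q := (4 * s + 4 + c) * (s - 2) / ((4 * s - 4 - c) * (s + 2)) with hQdef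
  have hQ1 : Q - 1 ≤ 2 * s * (c - 4) / (s ^ 2 - 4) := by
    have e : Q - 1 = 2 * s * (c - 4) / ((4 * s - 4 - c) * (s + 2)) := by
      rw [hQdef]; field_simp; ring
    rw [e]
    apply div_le_div_of_nonneg_left _ hsq
    · nlinarith
    · exact mul_nonneg (by linarith) (by linarith)
  have hQ : Q ≤ exp (Q - 1) := by linarith [add_one_le_exp (Q - 1)]
  have hkL : (k + 1) * L ≤ 2 * s - 2 * s * (c - 4) / (s ^ 2 - 4) := by
    calc (k + 1) * L ≤ (k + 1) * (4 * s / (s ^ 2 - 4)) := by gcongr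
      _ = 2 * s - 2 * s * (c - 4) / (s ^ 2 - 4) := by
        have : (k : ℝ) + 1 = (s ^ 2 - c) / 2 := by linarith
        rw [this]; field_simp; ring
  have key : exp (-(s + 2) ^ 2 / 4) * (s + 2) ^ (k + 1) * Q
      ≤ exp (-(s - 2) ^ 2 / 4) * (s - 2) ^ (k + 1) := by
    calc exp (-(s + 2) ^ 2 / 4) * (s + 2) ^ (k + 1) * Q
        ≤ exp (-(s + 2) ^ 2 / 4) * (s + 2) ^ (k + 1) * exp (Q - 1) := by gcongr
      _ = exp (-(s + 2) ^ 2 / 4 + (k + 1) * L + (Q - 1)) * (s - 2) ^ (k + 1) := by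
        have : exp ((k + 1) * L) = exp L ^ (k + 1) := by
          rw [← exp_nat_mul]; push_cast; rfl
        rw [exp_add, exp_add, this]
        have hpow : (s + 2) ^ (k + 1) = (s - 2) ^ (k + 1) * exp L ^ (k + 1) := by
          rw [← mul_pow, ← hexpL]
        rw [hpow]
        ring
      _ ≤ exp (-(s - 2) ^ 2 / 4) * (s - 2) ^ (k + 1) := by
        gcongr
        nlinarith
  have e1 : exp (-(s + 2) ^ 2 / 4) * (s + 2) ^ (k + 1) * Q
      = exp (-(s + 2) ^ 2 / 4) * (s + 2) ^ k * (4 * s + 4 + c) * ((s - 2) / (4 * s - 4 - c)) := by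
    rw [hQdef]; field_simp; ring
  have e2 : exp (-(s - 2) ^ 2 / 4) * (s - 2) ^ (k + 1)
      = exp (-(s - 2) ^ 2 / 4) * (s - 2) ^ k * (4 * s - 4 - c) * ((s - 2) / (4 * s - 4 - c)) := by
    field_simp; ring
  rw [e1, e2] at key
  exact le_of_mul_le_mul_right key (by positivity)

theorem Hfun_monotoneOn {k : ℕ} {a b : ℝ} (ha4 : 4 ≤ a) (ha : 2 * ((k : ℝ) + 1) + 6 ≤ a ^ 2)
    (hb : b ^ 2 ≤ 2 * ((k : ℝ) + 1) + 8) : MonotoneOn (Hfun (k + 1)) (Set.Icc a b) := by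
  apply monotoneOn_of_deriv_nonneg (convex_Icc a b)
  · exact fun s _ => (hasDerivAt_Hfun k s).continuousAt.continuousWithinAt
  · exact fun s _ => (hasDerivAt_Hfun k s).differentiableAt.differentiableWithinAt
  · intro s hs
    rw [interior_Icc] at hs
    obtain ⟨h1, h2⟩ := hs
    have h := exp_mul_pow_add_two_le (k := k) (s := s) (c := s ^ 2 - 2 * (k + 1))
      (by linarith) (by ring) (by nlinarith) (by nlinarith)
    rw [(hasDerivAt_Hfun k s).deriv]
    linear_combination h / 2

/-- **Appendix proposition, second half:** for `n ≥ 7` and `0 ≤ t ≤ r_{n+3} - r_{n+2}`,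
`4n r_{n+2} H_{n-2}(r_{n+2}) ≤ 2n (2 r_{n+2} + t) H_{n-2}(r_{n+2} + t)`. -/
theorem pointwise_right (n : ℕ) (hn : 7 ≤ n) (t : ℝ) (ht0 : 0 ≤ t)
    (ht1 : t ≤ rrad (n + 3) - rrad (n + 2)) :
    4 * n * rrad (n + 2) * Hfun (n - 2) (rrad (n + 2))
      ≤ 2 * n * (2 * rrad (n + 2) + t) * Hfun (n - 2) (rrad (n + 2) + t) := by
  obtain ⟨k, rfl⟩ : ∃ k, n = k + 3 := ⟨n - 3, by omega⟩
  have hk : (4 : ℝ) ≤ k := by exact_mod_cast (by omega : 4 ≤ k)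
  rw [show k + 3 - 2 = k + 1 by omega]
  set a := rrad (k + 3 + 2) with ha
  set b := rrad (k + 3 + 3) with hb
  have ha2 : a ^ 2 = 2 * ((k : ℝ) + 1) + 6 := by
    rw [ha, rrad, sq_sqrt (by push_cast; linarith)]; push_cast; ring
  have hb2 : b ^ 2 = 2 * ((k : ℝ) + 1) + 8 := by
    rw [hb, rrad, sq_sqrt (by push_cast; linarith)]; push_cast; ring
  have ha0 : 0 ≤ a := sqrt_nonneg _
  have ha4 : 4 ≤ a := by nlinarith
  have hmono : Hfun (k + 1) a ≤ Hfun (k + 1) (a + t) :=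
    Hfun_monotoneOn ha4 ha2.ge hb2.le ⟨le_rfl, by linarith⟩ ⟨by linarith, by linarith⟩
      (by linarith)
  have hpos : 0 ≤ Hfun (k + 1) a := by
    have h1 : 0 ≤ a - 2 := by linarith
    unfold Hfun hfun
    positivity
  calc 4 * ((k + 3 : ℕ) : ℝ) * a * Hfun (k + 1) a
      = 2 * ((k + 3 : ℕ) : ℝ) * (2 * a) * Hfun (k + 1) a := by ring
    _ ≤ 2 * ((k + 3 : ℕ) : ℝ) * (2 * a + t) * Hfun (k + 1) (a + t) := by
      gcongr
      linarith
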